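/- Suppose (A1)-(A3) hold, let Λ ⊂ {1,…,d}, and assume M^i ≥ 0 for all i ∈ Λ. Then for all sequences x'_n, x_n ∈ ℤ_+^{Λ,d} and ε_n > 0 with ε_n → 0, ε_n x'_n → 0 and ε_n x_n → M, one has liminf_{n→∞} ε_n log G_Λ(x'_n, x_n) = 0. -/

import Mathlib

open Filter Topology

attribute [local instance] Classical.propDecidable

noncomputable section

variable {V : Type*} [AddCommGroup V]

/-- `n`-step transition kernel of the random walk with step distribution `μ`,
killed upon leaving the set `A` : `kern μ A n x y = P_x(S n = y, τ_A > n)`,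
where `τ_A` is the first exit time from `A`. -/
def kern (μ : V → ℝ) (A : Set V) : ℕ → V → V → ℝ
  | 0 => fun x y => if x = y ∧ x ∈ A then 1 else 0
  | n + 1 => fun x y => ∑' z : V, (if x ∈ A then μ (z - x) else 0) * kern μ A n z y

/-- Green function of the walk killed outside `A`. -/
def green (μ : V → ℝ) (A : Set V) (x y : V) : ℝ :=
  ∑' n : ℕ, kern μ A n x y

/-- `E_x [ g(S τ) ; S τ ∈ B, τ < ∞ ]`, where `τ` is the first exit time from `A`. -/
def exitExp (μ : V → ℝ) (A B : Set V) (g : V → ℝ) (x : V) : ℝ :=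
  ∑' n : ℕ, ∑' z : V, kern μ A n x z *
    ∑' y : V, (if y ∉ A ∧ y ∈ B then μ (y - z) else 0) * g y

/-- `ℝ≥0∞`-valued version of `exitExp`. -/
def exitExpE (μ : V → ℝ) (A B : Set V) (g : V → ℝ) (x : V) : ENNReal :=
  ∑' n : ℕ, ∑' z : V, ENNReal.ofReal (kern μ A n x z) *
    ∑' y : V, ENNReal.ofReal ((if y ∉ A ∧ y ∈ B then μ (y - z) else 0) * g y)

/-- `P_x(S t = y for some t ≥ 0)` for the walk killed outside `A`
(first passage decomposition). -/
def hitProb (μ : V → ℝ) (A : Set V) (x y : V) : ℝ :=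
  (if x = y ∧ x ∈ A then 1 else 0) +
    ∑' n : ℕ, ∑' z : V, kern μ (A \ {y}) n x z * (if y ∈ A then μ (y - z) else 0)

/-- `h` is (strictly speaking, satisfies the mean value property of a) harmonic
function on `A` for the walk with step distribution `μ` killed outside `A`. -/
def HarmOn (μ : V → ℝ) (A : Set V) (h : V → ℝ) : Prop :=
  ∀ x ∈ A, h x = ∑' y : V, if y ∈ A then μ (y - x) * h y else 0

/-- Irreducibility of the walk killed outside `A`. -/
def Irred (μ : V → ℝ) (A : Set V) : Prop :=
  ∀ x ∈ A, ∀ x' ∈ A, ∃ (k : ℕ) (c : ℕ → V), c 0 = x ∧ c k = x' ∧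
    (∀ j ≤ k, c j ∈ A) ∧ ∀ j < k, 0 < μ (c (j + 1) - c j)

/-- A sequence `xs` is fundamental for the walk killed outside `A` :
the Martin kernels `G(x, xs n)/G(x₀, xs n)` converge for every `x ∈ A`. -/
def Fundamental (μ : V → ℝ) (A : Set V) (x₀ : V) (xs : ℕ → V) : Prop :=
  ∀ x ∈ A, ∃ L : ℝ,
    Tendsto (fun n => green μ A x (xs n) / green μ A x₀ (xs n)) atTop (𝓝 L)

/-- ℓ¹-norm of an integer vector. -/
def znorm {ι : Type*} [Fintype ι] (x : ι → ℤ) : ℝ := ∑ i, |(x i : ℝ)|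

/-- ℓ¹-norm of a real vector. -/
def rnorm {ι : Type*} [Fintype ι] (q : ι → ℝ) : ℝ := ∑ i, |q i|

variable {d : ℕ}

/-- `ℤ^{Λ,d}_+ = {x ∈ ℤ^d : xⁱ > 0 for all i ∈ Λ}`. -/
def posDom (Λ : Set (Fin d)) : Set (Fin d → ℤ) := {x | ∀ i ∈ Λ, 0 < x i}

/-- `ℤ^d_+ = {x ∈ ℤ^d : xⁱ > 0 for all i}`. -/
def posAll : Set (Fin d → ℤ) := {x | ∀ i, 0 < x i}

/-- `a · z` for `a ∈ ℝ^d`, `z ∈ ℤ^d`. -/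
def dotZ (a : Fin d → ℝ) (z : Fin d → ℤ) : ℝ := ∑ i, a i * (z i : ℝ)

/-- `a · q` for `a, q ∈ ℝ^d`. -/
def dotR (a q : Fin d → ℝ) : ℝ := ∑ i, a i * q i

/-- jump generating function `φ(a) = Σ_z μ(z) exp(a·z)` (valued in `ℝ≥0∞`). -/
def phiE (μ : (Fin d → ℤ) → ℝ) (a : Fin d → ℝ) : ENNReal :=
  ∑' z : Fin d → ℤ, ENNReal.ofReal (μ z * Real.exp (dotZ a z))

/-- `D = {a ∈ ℝ^d : φ(a) ≤ 1}`. -/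
def Dset (μ : (Fin d → ℤ) → ℝ) : Set (Fin d → ℝ) := {a | phiE μ a ≤ 1}

/-- mean vector `M = Σ_z μ(z) z`. -/
def Mvec (μ : (Fin d → ℤ) → ℝ) : Fin d → ℝ := fun i => ∑' z : Fin d → ℤ, μ z * (z i : ℝ)

/-- `Λ(M) = {i : Mⁱ = 0}`. -/
def LambdaM (μ : (Fin d → ℤ) → ℝ) : Set (Fin d) := {i | Mvec μ i = 0}

/-- Assumption (A1) : irreducibility on every `ℤ^{Λ,d}_+`. -/
def A1 (μ : (Fin d → ℤ) → ℝ) : Prop := ∀ Λ : Set (Fin d), Irred μ (posDom Λ)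

/-- Assumption (A2) : `φ` is finite on a neighborhood of the set `D`. -/
def A2 (μ : (Fin d → ℤ) → ℝ) : Prop :=
  ∃ U : Set (Fin d → ℝ), IsOpen U ∧ Dset μ ⊆ U ∧ ∀ a ∈ U, phiE μ a ≠ ⊤

/-- Assumption (A3) : `M ≠ 0`. -/
def A3 (μ : (Fin d → ℤ) → ℝ) : Prop := Mvec μ ≠ 0

/-- projection `x ↦ x^Λ`. -/
def projL (Λ : Set (Fin d)) (x : Fin d → ℤ) : ↥Λ → ℤ := fun i => x (i : Fin d)

/-- jump distribution `μ_Λ(v) = Σ_{x : x^Λ = v} μ(x)` of the projected walk. -/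
def muL (μ : (Fin d → ℤ) → ℝ) (Λ : Set (Fin d)) (v : ↥Λ → ℤ) : ℝ :=
  ∑' x : Fin d → ℤ, if projL Λ x = v then μ x else 0

/-- `ℤ^Λ_+`. -/
def posL (Λ : Set (Fin d)) : Set (↥Λ → ℤ) := {u | ∀ i, 0 < u i}

end

section GreenENNReal

variable {V : Type*} [AddCommGroup V]

/-- `ℝ≥0∞`-valued version of `kern`. -/
noncomputable def kernE (μ : V → ℝ) (A : Set V) : ℕ → V → V → ENNReal
  | 0 => fun x y => if x = y ∧ x ∈ A then 1 else 0
  | n + 1 => fun x y =>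
      ∑' z : V, (if x ∈ A then ENNReal.ofReal (μ (z - x)) else 0) * kernE μ A n z y

/-- `ℝ≥0∞`-valued version of `green`. -/
noncomputable def greenE (μ : V → ℝ) (A : Set V) (x y : V) : ENNReal :=
  ∑' n : ℕ, kernE μ A n x y

theorem toReal_kernE {μ : V → ℝ} (hnn : ∀ z, 0 ≤ μ z) {A : Set V}
    (hfin : ∀ n x y, kernE μ A n x y ≠ ⊤) (n : ℕ) (x y : V) :
    (kernE μ A n x y).toReal = kern μ A n x y := by
  induction n generalizing x with
  | zero => simp only [kernE, kern]; split_ifs <;> simp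
  | succ n ih =>
    simp only [kernE, kern]
    rw [ENNReal.tsum_toReal_eq]
    · refine tsum_congr fun z => ?_
      rw [ENNReal.toReal_mul, ih]
      split_ifs
      · rw [ENNReal.toReal_ofReal (hnn _)]
      · simp
    · intro z
      refine ENNReal.mul_ne_top ?_ (hfin n z y)
      split_ifs <;> simp

theorem toReal_greenE {μ : V → ℝ} (hnn : ∀ z, 0 ≤ μ z) {A : Set V}
    (hfin : ∀ n x y, kernE μ A n x y ≠ ⊤) (x y : V) :
    (greenE μ A x y).toReal = green μ A x y := by
  unfold greenE green
  rw [ENNReal.tsum_toReal_eq fun n => hfin n x y]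
  exact tsum_congr fun n => toReal_kernE hnn hfin n x y

theorem greenE_eq (μ : V → ℝ) (A : Set V) (x y : V) :
    greenE μ A x y = (if x = y ∧ x ∈ A then 1 else 0) +
      ∑' z : V, (if x ∈ A then ENNReal.ofReal (μ (z - x)) else 0) * greenE μ A z y := by
  unfold greenE
  rw [tsum_eq_zero_add' ENNReal.summable]
  simp only [kernE]
  rw [ENNReal.tsum_comm]
  simp only [ENNReal.tsum_mul_left]

theorem one_le_greenE_self (μ : V → ℝ) {A : Set V} {x : V} (hx : x ∈ A) :
    1 ≤ greenE μ A x x := by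
  rw [greenE_eq]
  simp [hx]

theorem tsum_step_greenE_le (μ : V → ℝ) {A : Set V} {x : V} (hx : x ∈ A) (y : V) :
    ∑' z : V, ENNReal.ofReal (μ (z - x)) * greenE μ A z y ≤ greenE μ A x y := by
  conv_rhs => rw [greenE_eq]
  simp [hx]

theorem step_greenE_le (μ : V → ℝ) {A : Set V} {x : V} (hx : x ∈ A) (y z : V) :
    ENNReal.ofReal (μ (z - x)) * greenE μ A z y ≤ greenE μ A x y :=
  (ENNReal.le_tsum z).trans (tsum_step_greenE_le μ hx y)

theorem tsum_step_eq_one {μ : V → ℝ} (hnn : ∀ z, 0 ≤ μ z) (hsum : HasSum μ 1) (x : V) :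
    ∑' z : V, ENNReal.ofReal (μ (z - x)) = 1 := by
  refine ((Equiv.subRight x).tsum_eq fun z => ENNReal.ofReal (μ z)).trans ?_
  rw [← ENNReal.ofReal_tsum_of_nonneg hnn hsum.summable, hsum.tsum_eq, ENNReal.ofReal_one]

/-- The Green function along a path of positive probability, uniformly over the translates of
the path that stay in the domain. -/
theorem exists_greenE_path_le {μ : V → ℝ} {A : Set V} (k : ℕ) (c : ℕ → V)
    (hc : ∀ j < k, 0 < μ (c (j + 1) - c j)) :
    ∃ κ : ℝ, 0 ≤ κ ∧ ∀ s : V, (∀ j ≤ k, c j + s ∈ A) → ∀ z,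
      ENNReal.ofReal (Real.exp (-κ)) * greenE μ A (c k + s) z ≤ greenE μ A (c 0 + s) z := by
  induction k with
  | zero => exact ⟨0, le_rfl, fun s _ z => by simp⟩
  | succ k ih =>
    obtain ⟨κ, hκ, h⟩ := ih fun j hj => hc j (hj.trans k.lt_succ_self)
    have hpos := hc k k.lt_succ_self
    set q := μ (c (k + 1) - c k) with hq
    refine ⟨κ + max 0 (-Real.log q), by positivity, fun s hs z => ?_⟩
    refine le_trans ?_ (h s (fun j hj => hs j (hj.trans k.le_succ)) z)
    rw [neg_add, Real.exp_add, ENNReal.ofReal_mul (Real.exp_nonneg _), mul_assoc]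
    gcongr
    refine le_trans ?_ (step_greenE_le μ (hs k k.le_succ) z (c (k + 1) + s))
    gcongr
    rw [add_sub_add_right_eq_sub, ← hq, ← Real.exp_log hpos, Real.exp_le_exp, Real.log_exp]
    linarith [le_max_right 0 (-Real.log q)]

/-- Lower bound for the Green function through a family of space-time superharmonic functions
that control the exit from `A` and the deviation from `B` at the terminal time. -/
theorem le_greenE_add {μ : V → ℝ} (hnn : ∀ z, 0 ≤ μ z) (hsum : HasSum μ 1) {A B : Set V}
    {z : V} {L : ENNReal} (hL : ∀ y ∈ A, y ∈ B → L ≤ greenE μ A y z) (N : ℕ)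
    (w : ℕ → V → ENNReal) (hB : ∀ x, x ∉ B → 1 ≤ w 0 x)
    (hA : ∀ m ≤ N, ∀ x, x ∉ A → 1 ≤ w m x)
    (hw : ∀ m x, ∑' y, ENNReal.ofReal (μ (y - x)) * w m y ≤ w (m + 1) x)
    (m : ℕ) (hm : m ≤ N) (x : V) : L ≤ greenE μ A x z + L * w m x := by
  have key : ∀ m x, 1 ≤ w m x → L ≤ greenE μ A x z + L * w m x := fun m x h =>
    (le_mul_of_one_le_right (by simp) h).trans le_add_self
  induction m generalizing x with
  | zero =>
    by_cases hx : x ∈ A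
    · by_cases hxB : x ∈ B
      · exact (hL x hx hxB).trans le_self_add
      · exact key _ _ (hB x hxB)
    · exact key _ _ (hA 0 hm x hx)
  | succ m ih =>
    by_cases hx : x ∈ A
    · calc L = ∑' y, ENNReal.ofReal (μ (y - x)) * L := by
            rw [ENNReal.tsum_mul_right, tsum_step_eq_one hnn hsum, one_mul]
        _ ≤ ∑' y, (ENNReal.ofReal (μ (y - x)) * greenE μ A y z +
              L * (ENNReal.ofReal (μ (y - x)) * w m y)) := by
            refine ENNReal.tsum_le_tsum fun y => ?_
            calc _ ≤ ENNReal.ofReal (μ (y - x)) * (greenE μ A y z + L * w m y) := by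
                  gcongr; exact ih (by omega) y
              _ = _ := by ring
        _ ≤ _ := by
            rw [ENNReal.tsum_add, ENNReal.tsum_mul_left]
            gcongr
            · exact tsum_step_greenE_le μ hx z
            · exact hw m x
    · exact key _ _ (hA _ hm x hx)

end GreenENNReal

section Exponentials

variable {d : ℕ}

theorem dotZ_add_right (a : Fin d → ℝ) (x y : Fin d → ℤ) :
    dotZ a (x + y) = dotZ a x + dotZ a y := by
  simp [dotZ, mul_add, Finset.sum_add_distrib]

theorem dotZ_smul (t : ℝ) (a : Fin d → ℝ) (x : Fin d → ℤ) :
    dotZ (t • a) x = t * dotZ a x := by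
  simp [dotZ, Finset.mul_sum, mul_assoc]

theorem dotZ_single (i : Fin d) (t : ℝ) (x : Fin d → ℤ) :
    dotZ (Pi.single i t) x = t * x i := by
  simp [dotZ, Pi.single_apply]

theorem tsum_step_exp {μ : (Fin d → ℤ) → ℝ} (hnn : ∀ z, 0 ≤ μ z) (a : Fin d → ℝ) (r : ℝ)
    (x : Fin d → ℤ) :
    ∑' y, ENNReal.ofReal (μ (y - x)) * ENNReal.ofReal (Real.exp (dotZ a y + r)) =
      phiE μ a * ENNReal.ofReal (Real.exp (dotZ a x + r)) := by
  rw [phiE, ← ENNReal.tsum_mul_right]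
  refine Eq.trans ?_ ((Equiv.subRight x).tsum_eq _)
  refine tsum_congr fun y => ?_
  have h : dotZ a y = dotZ a (y - x) + dotZ a x := by rw [← dotZ_add_right, sub_add_cancel]
  rw [Equiv.subRight_apply, ← ENNReal.ofReal_mul (hnn _),
    ← ENNReal.ofReal_mul (mul_nonneg (hnn _) (Real.exp_nonneg _)), mul_assoc, ← Real.exp_add,
    h, add_assoc]

theorem kernE_le {μ : (Fin d → ℤ) → ℝ} (hnn : ∀ z, 0 ≤ μ z) (A : Set (Fin d → ℤ))
    (a : Fin d → ℝ) (n : ℕ) (x z : Fin d → ℤ) :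
    kernE μ A n x z ≤ phiE μ a ^ n * ENNReal.ofReal (Real.exp (dotZ a x + -dotZ a z)) := by
  induction n generalizing x with
  | zero =>
    simp only [kernE]
    split_ifs with h
    · simp [h.1]
    · simp
  | succ n ih =>
    rw [pow_succ, mul_assoc, ← tsum_step_exp hnn, ← ENNReal.tsum_mul_left]
    refine ENNReal.tsum_le_tsum fun y => ?_
    calc _ ≤ ENNReal.ofReal (μ (y - x)) *
          (phiE μ a ^ n * ENNReal.ofReal (Real.exp (dotZ a y + -dotZ a z))) := by
          gcongr
          · split_ifs <;> simp
          · exact ih y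
      _ = _ := by ring

theorem greenE_le {μ : (Fin d → ℤ) → ℝ} (hnn : ∀ z, 0 ≤ μ z) (A : Set (Fin d → ℤ))
    (a : Fin d → ℝ) (x z : Fin d → ℤ) :
    greenE μ A x z ≤
      (1 - phiE μ a)⁻¹ * ENNReal.ofReal (Real.exp (dotZ a x + -dotZ a z)) := by
  rw [← ENNReal.tsum_geometric, ← ENNReal.tsum_mul_right]
  exact ENNReal.tsum_le_tsum fun n => kernE_le hnn A a n x z

theorem phiE_zero {μ : (Fin d → ℤ) → ℝ} (hnn : ∀ z, 0 ≤ μ z) (hsum : HasSum μ 1) :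
    phiE μ 0 = 1 := by
  simpa [phiE, dotZ] using tsum_step_eq_one hnn hsum 0

theorem exists_phiE_ne_top {μ : (Fin d → ℤ) → ℝ} (hnn : ∀ z, 0 ≤ μ z) (hsum : HasSum μ 1)
    (hA2 : A2 μ) (v : Fin d → ℝ) :
    ∃ t : ℝ, 0 < t ∧ phiE μ (t • v) ≠ ⊤ ∧ phiE μ (-t • v) ≠ ⊤ := by
  obtain ⟨U, hU, hDU, hfin⟩ := hA2
  have h0 : U ∈ 𝓝 (0 : Fin d → ℝ) := hU.mem_nhds (hDU (phiE_zero hnn hsum).le)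
  have h1 : ∀ᶠ t : ℝ in 𝓝 0, t • v ∈ U := by
    have : Tendsto (fun t : ℝ => t • v) (𝓝 0) (𝓝 0) := by
      have h : Continuous fun t : ℝ => t • v := by fun_prop
      simpa using h.tendsto 0
    exact this h0
  have h2 : ∀ᶠ t : ℝ in 𝓝 0, -t • v ∈ U := by
    have : Tendsto (fun t : ℝ => -t • v) (𝓝 0) (𝓝 0) := by
      have h : Continuous fun t : ℝ => -t • v := by fun_prop
      simpa using h.tendsto 0
    exact this h0
  obtain ⟨t, ⟨ha, hb⟩, ht⟩ :=
    (((h1.and h2).filter_mono nhdsWithin_le_nhds).and (self_mem_nhdsWithin (s := Set.Ioi 0))).exists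
  exact ⟨t, ht, hfin _ ha, hfin _ hb⟩

theorem summable_exp_of_phiE_ne_top {μ : (Fin d → ℤ) → ℝ} (hnn : ∀ z, 0 ≤ μ z)
    {a : Fin d → ℝ} (h : phiE μ a ≠ ⊤) : Summable fun z => μ z * Real.exp (dotZ a z) := by
  refine (ENNReal.summable_toReal h).congr fun z => ?_
  rw [ENNReal.toReal_ofReal (mul_nonneg (hnn _) (Real.exp_nonneg _))]

theorem phiE_eq_ofReal {μ : (Fin d → ℤ) → ℝ} (hnn : ∀ z, 0 ≤ μ z)
    {a : Fin d → ℝ} (h : Summable fun z => μ z * Real.exp (dotZ a z)) :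
    phiE μ a = ENNReal.ofReal (∑' z, μ z * Real.exp (dotZ a z)) :=
  (ENNReal.ofReal_tsum_of_nonneg (fun z => mul_nonneg (hnn z) (Real.exp_nonneg _)) h).symm

theorem abs_le_exp_add_exp {t : ℝ} (ht : 0 < t) (s : ℝ) :
    |s| ≤ t⁻¹ * (Real.exp (t * s) + Real.exp (-t * s)) := by
  rw [inv_mul_eq_div, le_div_iff₀ ht]
  have h1 := Real.add_one_le_exp (t * s)
  have h2 := Real.add_one_le_exp (-t * s)
  have h3 := Real.exp_pos (t * s)
  have h4 := Real.exp_pos (-t * s)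
  rcases abs_cases s with ⟨h, -⟩ | ⟨h, -⟩ <;> rw [h] <;> linarith

theorem summable_mul_dotZ {μ : (Fin d → ℤ) → ℝ} (hnn : ∀ z, 0 ≤ μ z) (hsum : HasSum μ 1)
    (hA2 : A2 μ) (v : Fin d → ℝ) : Summable fun z => μ z * |dotZ v z| := by
  obtain ⟨t, ht, h1, h2⟩ := exists_phiE_ne_top hnn hsum hA2 v
  refine Summable.of_nonneg_of_le (fun z => mul_nonneg (hnn z) (abs_nonneg _)) (fun z => ?_)
    (((summable_exp_of_phiE_ne_top hnn h1).add (summable_exp_of_phiE_ne_top hnn h2)).mul_left t⁻¹)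
  rw [dotZ_smul, dotZ_smul, ← mul_add, mul_left_comm]
  exact mul_le_mul_of_nonneg_left (abs_le_exp_add_exp ht _) (hnn z)

theorem hasSum_mul_dotZ {μ : (Fin d → ℤ) → ℝ} (hnn : ∀ z, 0 ≤ μ z) (hsum : HasSum μ 1)
    (hA2 : A2 μ) (v : Fin d → ℝ) : HasSum (fun z => μ z * dotZ v z) (dotR v (Mvec μ)) := by
  have h : ∀ i, HasSum (fun z : Fin d → ℤ => v i * (μ z * (z i : ℝ))) (v i * Mvec μ i) := by
    intro i
    refine HasSum.mul_left _ (Summable.hasSum ?_)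
    refine ((summable_mul_dotZ hnn hsum hA2 (Pi.single i 1)).congr fun z => ?_).of_norm
    simp [dotZ_single, abs_of_nonneg (hnn z)]
  convert hasSum_sum fun i (_ : i ∈ Finset.univ) => h i using 1
  · funext z
    rw [dotZ, Finset.mul_sum]
    exact Finset.sum_congr rfl fun i _ => by ring
  · rfl

theorem abs_exp_mul_sub_one_div_le {t t₀ : ℝ} (ht : 0 < t) (htt : t ≤ t₀) (s : ℝ) :
    |(Real.exp (t * s) - 1) / t| ≤ |s| + t₀⁻¹ * (Real.exp (t₀ * s) + 1) := by
  have ht₀ := ht.trans_le htt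
  have hpos : 0 < t₀⁻¹ * (Real.exp (t₀ * s) + 1) := by positivity
  have hlow : s ≤ (Real.exp (t * s) - 1) / t := by
    rw [le_div_iff₀ ht]
    linarith [Real.add_one_le_exp (t * s)]
  have hup : (Real.exp (t * s) - 1) / t ≤ t₀⁻¹ * (Real.exp (t₀ * s) - 1) := by
    have h := convexOn_exp.2 (Set.mem_univ (t₀ * s)) (Set.mem_univ 0)
      (show 0 ≤ t / t₀ by positivity)
      (sub_nonneg.2 ((div_le_one ht₀).2 htt)) (add_sub_cancel _ _)
    simp only [smul_eq_mul, mul_zero, add_zero, Real.exp_zero, mul_one] at h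
    rw [show t / t₀ * (t₀ * s) = t * s by field_simp] at h
    rw [div_le_iff₀ ht]
    calc _ ≤ t / t₀ * Real.exp (t₀ * s) - t / t₀ := by linarith
      _ = _ := by ring
  have : t₀⁻¹ * (Real.exp (t₀ * s) - 1) ≤ t₀⁻¹ * (Real.exp (t₀ * s) + 1) := by
    gcongr
    linarith
  rw [abs_le]
  constructor <;> linarith [neg_abs_le s, le_abs_self s, abs_nonneg s]

/-- Upper right-derivative bound for the jump generating function at the origin. -/
theorem eventually_phiE_le {μ : (Fin d → ℤ) → ℝ} (hnn : ∀ z, 0 ≤ μ z) (hsum : HasSum μ 1)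
    (hA2 : A2 μ) (v : Fin d → ℝ) {b : ℝ} (hb : dotR v (Mvec μ) < b) :
    ∀ᶠ t : ℝ in 𝓝[>] 0, phiE μ (t • v) ≤ ENNReal.ofReal (1 + t * b) := by
  obtain ⟨t₀, ht₀, h1, h2⟩ := exists_phiE_ne_top hnn hsum hA2 v
  have hs := summable_exp_of_phiE_ne_top hnn h1
  have hmem : ∀ᶠ t in 𝓝[>] (0 : ℝ), t ∈ Set.Ioc 0 t₀ := Ioc_mem_nhdsGT ht₀
  simp only [dotZ_smul] at hs
  have hbound : Summable fun z => μ z * |dotZ v z| +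
      t₀⁻¹ * (μ z * Real.exp (t₀ * dotZ v z) + μ z) :=
    (summable_mul_dotZ hnn hsum hA2 v).add ((hs.add hsum.summable).mul_left _)
  have hle : ∀ t ∈ Set.Ioc 0 t₀, ∀ z, ‖μ z * ((Real.exp (t * dotZ v z) - 1) / t)‖ ≤
      μ z * |dotZ v z| + t₀⁻¹ * (μ z * Real.exp (t₀ * dotZ v z) + μ z) := by
    intro t ht z
    rw [norm_mul, Real.norm_of_nonneg (hnn z), Real.norm_eq_abs]
    refine (mul_le_mul_of_nonneg_left (abs_exp_mul_sub_one_div_le ht.1 ht.2 _) (hnn z)).trans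
      (le_of_eq (by ring))
  have hlim : Tendsto (fun t => ∑' z, μ z * ((Real.exp (t * dotZ v z) - 1) / t)) (𝓝[>] 0)
      (𝓝 (∑' z, μ z * dotZ v z)) := by
    refine tendsto_tsum_of_dominated_convergence hbound (fun z => ?_) (hmem.mono hle)
    refine Tendsto.const_mul _ ?_
    have hd : HasDerivAt (fun t : ℝ => Real.exp (t * dotZ v z)) (dotZ v z) 0 := by
      simpa using ((hasDerivAt_id (0 : ℝ)).mul_const (dotZ v z)).exp
    refine (hd.tendsto_slope_zero_right).congr fun t => ?_
    simp [div_eq_inv_mul]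
  rw [(hasSum_mul_dotZ hnn hsum hA2 v).tsum_eq] at hlim
  filter_upwards [hlim.eventually_lt_const hb, hmem] with t hlt ht
  have hsum' := (Summable.of_norm_bounded hbound (hle t ht)).hasSum
  have heq : (fun z => μ z + t * (μ z * ((Real.exp (t * dotZ v z) - 1) / t))) =
      fun z => μ z * Real.exp (dotZ (t • v) z) := by
    funext z
    have := ht.1.ne'
    rw [dotZ_smul]
    field_simp
    ring
  have hφ := hsum.add (hsum'.mul_left t)
  rw [heq] at hφ
  rw [phiE_eq_ofReal hnn hφ.summable, hφ.tsum_eq]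
  have := ht.1
  gcongr

end Exponentials

section Comparison

variable {d : ℕ}

theorem exists_greenE_translate_le {μ : (Fin d → ℤ) → ℝ} (hA1 : A1 μ) (Λ : Set (Fin d))
    {u v : Fin d → ℤ} (hu : ∀ i, 0 < u i) (hv : ∀ i, 0 < v i) :
    ∃ κ : ℝ, 0 ≤ κ ∧ ∀ s : Fin d → ℤ, (∀ i ∈ Λ, 0 ≤ s i) → ∀ z,
      ENNReal.ofReal (Real.exp (-κ)) * greenE μ (posDom Λ) (v + s) z ≤
        greenE μ (posDom Λ) (u + s) z := by
  obtain ⟨k, c, rfl, rfl, hc, hpos⟩ := hA1 Set.univ u (fun i _ => hu i) v (fun i _ => hv i)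
  obtain ⟨κ, hκ, h⟩ := exists_greenE_path_le (A := posDom Λ) k c hpos
  exact ⟨κ, hκ, fun s hs => h s fun j hj i hi =>
    add_pos_of_pos_of_nonneg (hc j hj i trivial) (hs i hi)⟩

theorem exists_greenE_neighbor_le {μ : (Fin d → ℤ) → ℝ} (hA1 : A1 μ) (Λ : Set (Fin d)) :
    ∃ κ : ℝ, 0 ≤ κ ∧ ∀ x ∈ posDom Λ, ∀ i, ∀ z,
      ENNReal.ofReal (Real.exp (-κ)) * greenE μ (posDom Λ) (x + Pi.single i 1) z ≤
        greenE μ (posDom Λ) x z ∧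
      ENNReal.ofReal (Real.exp (-κ)) * greenE μ (posDom Λ) x z ≤
        greenE μ (posDom Λ) (x + Pi.single i 1) z := by
  have hone : ∀ i : Fin d, 0 < (1 : Fin d → ℤ) i := fun i => by simp
  have htwo : ∀ j i : Fin d, 0 < (1 + Pi.single j 1 : Fin d → ℤ) i := fun j i => by
    by_cases h : i = j <;> simp [h]
  choose f hf hf' using fun i => exists_greenE_translate_le hA1 Λ hone (htwo i)
  choose g hg hg' using fun i => exists_greenE_translate_le hA1 Λ (htwo i) hone
  refine ⟨∑ i, (f i + g i), Finset.sum_nonneg fun i _ => add_nonneg (hf i) (hg i),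
    fun x hx i z => ?_⟩
  have hle : f i + g i ≤ ∑ i, (f i + g i) :=
    Finset.single_le_sum (f := fun i => f i + g i) (fun i _ => add_nonneg (hf i) (hg i))
      (Finset.mem_univ i)
  have hs : ∀ i ∈ Λ, 0 ≤ (x - 1) i := fun i hi => by
    have := hx i hi
    simp only [Pi.sub_apply, Pi.one_apply]
    omega
  have e1 : 1 + (x - 1) = x := add_sub_cancel _ _
  have e2 : 1 + Pi.single i 1 + (x - 1) = x + Pi.single i 1 := by abel
  have h1 := hf' i (x - 1) hs z
  have h2 := hg' i (x - 1) hs z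
  rw [e1, e2] at h1 h2
  constructor
  · refine le_trans ?_ h1
    gcongr
    linarith [hg i]
  · refine le_trans ?_ h2
    gcongr
    linarith [hf i]

/-- Harnack-type comparison of the Green function at two starting points. -/
theorem exists_greenE_le_of_znorm {μ : (Fin d → ℤ) → ℝ} (hA1 : A1 μ) (Λ : Set (Fin d)) :
    ∃ κ : ℝ, 0 ≤ κ ∧ ∀ x ∈ posDom Λ, ∀ y ∈ posDom Λ, ∀ z,
      ENNReal.ofReal (Real.exp (-(κ * znorm (x - y)))) * greenE μ (posDom Λ) y z ≤
        greenE μ (posDom Λ) x z := by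
  obtain ⟨κ, hκ, h⟩ := exists_greenE_neighbor_le hA1 Λ
  refine ⟨κ, hκ, fun x hx y hy z => ?_⟩
  obtain ⟨n, hn⟩ : ∃ n : ℕ, ∑ i, (x i - y i).natAbs = n := ⟨_, rfl⟩
  have hnorm : znorm (x - y) = n := by
    rw [znorm, ← hn]
    push_cast
    refine Finset.sum_congr rfl fun i _ => ?_
    rw [Nat.cast_natAbs]
    simp
  rw [hnorm]
  clear hnorm
  induction n generalizing x with
  | zero =>
    have : x = y := by
      funext i
      have := (Finset.sum_eq_zero_iff.1 hn) i (Finset.mem_univ i)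
      omega
    simp [this]
  | succ n ih =>
    obtain ⟨i, hi⟩ : ∃ i, x i ≠ y i := by
      by_contra! hxy
      simp [hxy] at hn
    have hexp : Real.exp (-(κ * (n + 1 : ℕ))) = Real.exp (-κ) * Real.exp (-(κ * n)) := by
      rw [← Real.exp_add]
      push_cast
      ring_nf
    obtain ⟨x', hx', hn', hG⟩ : ∃ x' ∈ posDom Λ, ∑ i, (x' i - y i).natAbs = n ∧
        ENNReal.ofReal (Real.exp (-κ)) * greenE μ (posDom Λ) x' z ≤
          greenE μ (posDom Λ) x z := by
      have hsum : ∀ σ : ℤ, (x i + σ - y i).natAbs + 1 = (x i - y i).natAbs →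
          ∑ j, ((x + Pi.single i σ : Fin d → ℤ) j - y j).natAbs = n := by
        intro σ hσ
        rw [← Finset.add_sum_erase _ _ (Finset.mem_univ i)] at hn ⊢
        have : ∑ j ∈ Finset.univ.erase i, ((x + Pi.single i σ : Fin d → ℤ) j - y j).natAbs =
            ∑ j ∈ Finset.univ.erase i, (x j - y j).natAbs :=
          Finset.sum_congr rfl fun j hj => by simp [Finset.ne_of_mem_erase hj]
        rw [this]
        simp only [Pi.add_apply, Pi.single_eq_same]
        omega
      rcases lt_or_gt_of_ne hi with hlt | hgt
      · refine ⟨x + Pi.single i 1, fun j hj => ?_, hsum 1 (by omega), (h x hx i z).1⟩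
        have := hx j hj
        by_cases hij : j = i <;> simp [hij] <;> grind
      · have hmem : x + Pi.single i (-1) ∈ posDom Λ := fun j hj => by
          have := hx j hj
          have := hy j hj
          by_cases hij : j = i
          · subst hij; simp; omega
          · simpa [Pi.single_apply, hij]
        refine ⟨x + Pi.single i (-1), hmem, hsum (-1) (by omega), ?_⟩
        have := (h _ hmem i z).2
        rwa [add_assoc, ← Pi.single_add, neg_add_cancel, Pi.single_zero, add_zero] at this
    rw [hexp, ENNReal.ofReal_mul (Real.exp_nonneg _), mul_assoc]
    refine le_trans ?_ hG
    gcongr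
    exact ih x' hx' hn'

end Comparison

section Tube

variable {d : ℕ}

/-- The `2 d` signed coordinate directions. -/
def signedBasis (p : Fin d × Bool) : Fin d → ℝ := Pi.single p.1 (if p.2 then 1 else -1)

theorem exists_phiE_signedBasis_le {μ : (Fin d → ℤ) → ℝ} (hnn : ∀ z, 0 ≤ μ z)
    (hsum : HasSum μ 1) (hA2 : A2 μ) {δ : ℝ} (hδ : 0 < δ) :
    ∃ t : ℝ, 0 < t ∧ ∀ p : Fin d × Bool, phiE μ (t • signedBasis p) ≤
      ENNReal.ofReal (Real.exp (t * (dotR (signedBasis p) (Mvec μ) + δ))) := by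
  have h : ∀ᶠ t : ℝ in 𝓝[>] 0, ∀ p : Fin d × Bool, phiE μ (t • signedBasis p) ≤
      ENNReal.ofReal (1 + t * (dotR (signedBasis p) (Mvec μ) + δ)) :=
    Filter.eventually_all.2 fun p => eventually_phiE_le hnn hsum hA2 _ (by linarith)
  obtain ⟨t, ht, hpos⟩ := (h.and (self_mem_nhdsWithin (s := Set.Ioi 0))).exists
  refine ⟨t, hpos, fun p => (ht p).trans (ENNReal.ofReal_le_ofReal ?_)⟩
  linarith [Real.add_one_le_exp (t * (dotR (signedBasis p) (Mvec μ) + δ))]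

/-- Lower bound for the Green function of a walk that starts at distance at least `r` from the
boundary and follows its mean drift for `N` steps within a tube of radius `r`. -/
theorem half_le_greenE {μ : (Fin d → ℤ) → ℝ} (hnn : ∀ z, 0 ≤ μ z) (hsum : HasSum μ 1)
    {Λ : Set (Fin d)} (hM : ∀ i ∈ Λ, 0 ≤ Mvec μ i) {δ t : ℝ} (hδ : 0 ≤ δ) (ht : 0 < t)
    (hφ : ∀ p : Fin d × Bool, phiE μ (t • signedBasis p) ≤
      ENNReal.ofReal (Real.exp (t * (dotR (signedBasis p) (Mvec μ) + δ))))
    {x₀ z : Fin d → ℤ} {N : ℕ} {r : ℝ} (hr : ∀ i ∈ Λ, r ≤ x₀ i)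
    (hsmall : Fintype.card (Fin d × Bool) * Real.exp (t * (N * δ - r)) ≤ 1 / 2)
    {L : ENNReal} (hLtop : L ≠ ⊤)
    (hL : ∀ y ∈ posDom Λ, (∀ i, |(y i : ℝ) - (x₀ i + N * Mvec μ i)| ≤ r) →
      L ≤ greenE μ (posDom Λ) y z) :
    L / 2 ≤ greenE μ (posDom Λ) x₀ z := by
  have hZ : ∀ (i : Fin d) (b : Bool) (x : Fin d → ℤ),
      dotZ (t • signedBasis (i, b)) x = t * ((if b then 1 else -1) * x i) := fun i b x => by
    rw [dotZ_smul, signedBasis, dotZ_single]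
  have hR : ∀ (i : Fin d) (b : Bool),
      dotR (signedBasis (i, b)) (Mvec μ) = (if b then 1 else -1) * Mvec μ i := fun i b => by
    simp [signedBasis, dotR, Pi.single_apply]
  set e : ℕ → Fin d × Bool → ℝ := fun m p => m * (t * (dotR (signedBasis p) (Mvec μ) + δ)) -
    (dotZ (t • signedBasis p) x₀ + N * (t * dotR (signedBasis p) (Mvec μ)) + t * r) with he
  set w : ℕ → (Fin d → ℤ) → ENNReal := fun m x =>
    ∑ p, ENNReal.ofReal (Real.exp (dotZ (t • signedBasis p) x + e m p)) with hwdef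
  have hge : ∀ m x p, 0 ≤ dotZ (t • signedBasis p) x + e m p → 1 ≤ w m x := by
    intro m x p hp
    refine le_trans ?_ (Finset.single_le_sum (fun _ _ => by simp) (Finset.mem_univ p))
    rw [← ENNReal.ofReal_one]
    exact ENNReal.ofReal_le_ofReal (Real.one_le_exp hp)
  have key := le_greenE_add hnn hsum (A := posDom Λ)
    (B := {y | ∀ i, |(y i : ℝ) - (x₀ i + N * Mvec μ i)| ≤ r}) (z := z) hL N w ?_ ?_ ?_ N le_rfl x₀
  · have hw : w N x₀ ≤ 2⁻¹ := by
      have : w N x₀ = ENNReal.ofReal (Fintype.card (Fin d × Bool) *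
          Real.exp (t * (N * δ - r))) := by
        rw [ENNReal.ofReal_mul (by positivity), ENNReal.ofReal_natCast]
        simp only [hwdef, he]
        rw [Finset.sum_congr rfl (g := fun _ => ENNReal.ofReal (Real.exp (t * (N * δ - r))))]
        · simp
        · intro p _
          ring_nf
      rw [this]
      refine (ENNReal.ofReal_le_ofReal hsmall).trans (le_of_eq ?_)
      rw [one_div, ENNReal.ofReal_inv_of_pos two_pos, ENNReal.ofReal_ofNat]
    have h2 : L / 2 + L / 2 ≤ greenE μ (posDom Λ) x₀ z + L / 2 := by
      rw [ENNReal.add_halves]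
      refine key.trans ?_
      rw [ENNReal.div_eq_inv_mul, mul_comm]
      gcongr
    exact (ENNReal.add_le_add_iff_right (ENNReal.div_ne_top hLtop two_ne_zero)).1 h2
  · intro x hx
    simp only [Set.mem_ofPred_eq, not_forall, not_le] at hx
    obtain ⟨i, hi⟩ := hx
    rcases lt_abs.1 hi with h | h
    · refine hge 0 x (i, true) ?_
      simp only [he, hZ, hR]
      have := mul_pos ht (sub_pos.2 h)
      simp
      linarith
    · refine hge 0 x (i, false) ?_
      simp only [he, hZ, hR]
      have := mul_pos ht (sub_pos.2 h)
      simp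
      linarith
  · intro m hm x hx
    simp only [posDom, Set.mem_ofPred_eq, not_forall, not_lt] at hx
    obtain ⟨i, hi, hxi⟩ := hx
    refine hge m x (i, false) ?_
    simp only [he, hZ, hR]
    have hx0 : (x i : ℝ) ≤ 0 := by exact_mod_cast hxi
    have hm' : (0 : ℝ) ≤ N - m := sub_nonneg.2 (by exact_mod_cast hm)
    have h1 : 0 ≤ t * ((x₀ i - r) + (N - m) * Mvec μ i + m * δ - x i) := by
      have := mul_nonneg hm' (hM i hi)
      have : 0 ≤ m * δ := by positivity
      have := hr i hi
      exact mul_nonneg ht.le (by linarith)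
    simp
    linarith
  · intro m x
    simp only [hwdef, Finset.mul_sum]
    rw [Summable.tsum_finsetSum fun _ _ => ENNReal.summable]
    refine Finset.sum_le_sum fun p _ => ?_
    rw [tsum_step_exp hnn]
    refine (mul_le_mul_left (hφ p) _).trans (le_of_eq ?_)
    rw [← ENNReal.ofReal_mul (Real.exp_nonneg _), ← Real.exp_add]
    simp only [he]
    push_cast
    ring_nf

end Tube

section Asymptotics

variable {d : ℕ}

theorem tendsto_mul_dotZ {ε : ℕ → ℝ} {xs : ℕ → Fin d → ℤ} {q : Fin d → ℝ}
    (h : Tendsto (fun n i => ε n * (xs n i : ℝ)) atTop (𝓝 q)) (a : Fin d → ℝ) :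
    Tendsto (fun n => ε n * dotZ a (xs n)) atTop (𝓝 (dotR a q)) := by
  have : Tendsto (fun n => ∑ i, a i * (ε n * (xs n i : ℝ))) atTop (𝓝 (∑ i, a i * q i)) :=
    tendsto_finsetSum _ fun i _ => (tendsto_pi_nhds.1 h i).const_mul _
  refine this.congr fun n => ?_
  rw [dotZ, Finset.mul_sum]
  exact Finset.sum_congr rfl fun i _ => by ring

theorem exists_phiE_neg_Mvec_lt_one {μ : (Fin d → ℤ) → ℝ} (hnn : ∀ z, 0 ≤ μ z)
    (hsum : HasSum μ 1) (hA2 : A2 μ) (hA3 : A3 μ) {δ : ℝ} (hδ : 0 < δ) :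
    ∃ t : ℝ, 0 < t ∧ t < δ ∧ phiE μ (t • -Mvec μ) < 1 := by
  have hneg : dotR (-Mvec μ) (Mvec μ) < 0 := by
    obtain ⟨i, hi⟩ := Function.ne_iff.1 hA3
    have : 0 < ∑ i, Mvec μ i * Mvec μ i :=
      Finset.sum_pos' (fun i _ => mul_self_nonneg _) ⟨i, Finset.mem_univ i, mul_self_pos.2 hi⟩
    simpa [dotR] using this
  have h := eventually_phiE_le hnn hsum hA2 (-Mvec μ)
    (b := dotR (-Mvec μ) (Mvec μ) / 2) (by linarith)
  obtain ⟨t, ht, h0, hlt⟩ := (h.and (Ioo_mem_nhdsGT hδ)).exists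
  refine ⟨t, h0, hlt, ht.trans_lt ?_⟩
  rw [ENNReal.ofReal_lt_one]
  nlinarith

theorem kernE_ne_top {μ : (Fin d → ℤ) → ℝ} (hnn : ∀ z, 0 ≤ μ z) (hsum : HasSum μ 1)
    (A : Set (Fin d → ℤ)) (n : ℕ) (x y : Fin d → ℤ) : kernE μ A n x y ≠ ⊤ := by
  refine ((kernE_le hnn A 0 n x y).trans_lt ?_).ne
  simp [phiE_zero hnn hsum]

theorem greenE_ne_top {μ : (Fin d → ℤ) → ℝ} (hnn : ∀ z, 0 ≤ μ z) (hsum : HasSum μ 1)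
    (hA2 : A2 μ) (hA3 : A3 μ) (A : Set (Fin d → ℤ)) (x y : Fin d → ℤ) :
    greenE μ A x y ≠ ⊤ := by
  obtain ⟨t, -, -, hφ⟩ := exists_phiE_neg_Mvec_lt_one hnn hsum hA2 hA3 one_pos
  refine ne_top_of_le_ne_top (ENNReal.mul_ne_top ?_ ENNReal.ofReal_ne_top) 
    (greenE_le hnn A (t • -Mvec μ) x y)
  exact ENNReal.inv_ne_top.2 (tsub_pos_of_lt hφ).ne'

theorem green_pos {μ : (Fin d → ℤ) → ℝ} (hnn : ∀ z, 0 ≤ μ z) (hsum : HasSum μ 1)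
    (hA1 : A1 μ) (hA2 : A2 μ) (hA3 : A3 μ) {Λ : Set (Fin d)} {x y : Fin d → ℤ}
    (hx : x ∈ posDom Λ) (hy : y ∈ posDom Λ) : 0 < green μ (posDom Λ) x y := by
  rw [← toReal_greenE hnn (kernE_ne_top hnn hsum _)]
  refine ENNReal.toReal_pos ?_ (greenE_ne_top hnn hsum hA2 hA3 _ x y)
  obtain ⟨κ, -, h⟩ := exists_greenE_le_of_znorm hA1 Λ
  refine (lt_of_lt_of_le ?_ (h x hx y hy y)).ne'
  exact ENNReal.mul_pos (ENNReal.ofReal_pos.2 (Real.exp_pos _)).ne'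
    (zero_lt_one.trans_le (one_le_greenE_self μ hy)).ne'

theorem eventually_mul_log_green_lt {μ : (Fin d → ℤ) → ℝ} (hnn : ∀ z, 0 ≤ μ z)
    (hsum : HasSum μ 1) (hA1 : A1 μ) (hA2 : A2 μ) (hA3 : A3 μ) {Λ : Set (Fin d)}
    {xs xs' : ℕ → Fin d → ℤ} (hxs : ∀ n, xs n ∈ posDom Λ) (hxs' : ∀ n, xs' n ∈ posDom Λ)
    {ε : ℕ → ℝ} (hε : ∀ n, 0 < ε n) (hε0 : Tendsto ε atTop (𝓝 0))
    (h1 : Tendsto (fun n i => ε n * (xs' n i : ℝ)) atTop (𝓝 0))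
    (h2 : Tendsto (fun n i => ε n * (xs n i : ℝ)) atTop (𝓝 (Mvec μ))) {a : ℝ} (ha : 0 < a) :
    ∀ᶠ n in atTop, ε n * Real.log (green μ (posDom Λ) (xs' n) (xs n)) < a := by
  set S := dotR (Mvec μ) (Mvec μ) with hS
  have hS0 : 0 ≤ S := Finset.sum_nonneg fun i _ => mul_self_nonneg _
  obtain ⟨t, ht, hlt, hφ⟩ := exists_phiE_neg_Mvec_lt_one hnn hsum hA2 hA3
    (δ := a / (S + 1)) (by positivity)
  rw [lt_div_iff₀ (by positivity)] at hlt
  set v := t • -Mvec μ with hv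
  set K := (1 - phiE μ v)⁻¹ with hK
  have hKtop : K ≠ ⊤ := ENNReal.inv_ne_top.2 (tsub_pos_of_lt hφ).ne'
  have hle : ∀ n, ε n * Real.log (green μ (posDom Λ) (xs' n) (xs n)) ≤
      ε n * Real.log K.toReal + (ε n * dotZ v (xs' n) - ε n * dotZ v (xs n)) := by
    intro n
    have hpos := green_pos hnn hsum hA1 hA2 hA3 (hxs' n) (hxs n)
    have hG : green μ (posDom Λ) (xs' n) (xs n) ≤
        K.toReal * Real.exp (dotZ v (xs' n) + -dotZ v (xs n)) := by
      rw [← toReal_greenE hnn (kernE_ne_top hnn hsum _),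
        ← ENNReal.toReal_ofReal (Real.exp_nonneg (dotZ v (xs' n) + -dotZ v (xs n))),
        ← ENNReal.toReal_mul]
      exact ENNReal.toReal_mono (ENNReal.mul_ne_top hKtop ENNReal.ofReal_ne_top)
        (greenE_le hnn _ v _ _)
    have hK0 : K.toReal ≠ 0 := fun h => by
      rw [h, zero_mul] at hG
      linarith
    have := Real.log_le_log hpos hG
    rw [Real.log_mul hK0 (Real.exp_pos _).ne', Real.log_exp] at this
    calc _ ≤ ε n * (Real.log K.toReal + (dotZ v (xs' n) + -dotZ v (xs n))) :=
          mul_le_mul_of_nonneg_left this (hε n).le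
      _ = _ := by ring
  have hlim := (hε0.mul_const (Real.log K.toReal)).add
    ((tendsto_mul_dotZ h1 v).sub (tendsto_mul_dotZ h2 v))
  have hval : 0 * Real.log K.toReal + (dotR v 0 - dotR v (Mvec μ)) = t * S := by
    simp [dotR, hv, hS, Finset.mul_sum, mul_assoc]
  rw [hval] at hlim
  filter_upwards [hlim.eventually_lt_const (show t * S < a by linarith)] with n hn
  exact (hle n).trans_lt hn

theorem znorm_le_sum {x : Fin d → ℤ} {b : Fin d → ℝ} (h : ∀ i, |(x i : ℝ)| ≤ b i) :
    znorm x ≤ ∑ i, b i :=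
  Finset.sum_le_sum fun i _ => h i

theorem eventually_lt_mul_log_green {μ : (Fin d → ℤ) → ℝ} (hnn : ∀ z, 0 ≤ μ z)
    (hsum : HasSum μ 1) (hA1 : A1 μ) (hA2 : A2 μ) (hA3 : A3 μ) {Λ : Set (Fin d)}
    (hM : ∀ i ∈ Λ, 0 ≤ Mvec μ i)
    {xs xs' : ℕ → Fin d → ℤ} (hxs : ∀ n, xs n ∈ posDom Λ) (hxs' : ∀ n, xs' n ∈ posDom Λ)
    {ε : ℕ → ℝ} (hε : ∀ n, 0 < ε n) (hε0 : Tendsto ε atTop (𝓝 0))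
    (h1 : Tendsto (fun n i => ε n * (xs' n i : ℝ)) atTop (𝓝 0))
    (h2 : Tendsto (fun n i => ε n * (xs n i : ℝ)) atTop (𝓝 (Mvec μ))) {a : ℝ} (ha : a < 0) :
    ∀ᶠ n in atTop, a < ε n * Real.log (green μ (posDom Λ) (xs' n) (xs n)) := by
  obtain ⟨κ, hκ, hHarnack⟩ := exists_greenE_le_of_znorm hA1 Λ
  obtain ⟨η, hη, hηa⟩ : ∃ η : ℝ, 0 < η ∧ κ * (d * (5 * η)) < -a / 2 := by
    refine ⟨-a / (10 * κ * d + 1) / 2, by have := neg_pos.2 ha; positivity, ?_⟩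
    have h0 : 0 ≤ κ * d := by positivity
    have : κ * (d * (5 * (-a / (10 * κ * d + 1) / 2))) =
        (-a / 2) * ((5 * (κ * d)) / (10 * (κ * d) + 1)) := by field_simp
    rw [this]
    refine mul_lt_of_lt_one_right (by linarith) ?_
    rw [div_lt_one (by positivity)]
    linarith
  obtain ⟨t, ht, hφ⟩ := exists_phiE_signedBasis_le hnn hsum hA2 (half_pos hη)
  set C := Real.log 2 + κ * ∑ i, (2 + |Mvec μ i|) with hC
  have hinv : Tendsto (fun n => (ε n)⁻¹) atTop atTop :=
    tendsto_inv_nhdsGT_zero.comp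
      (tendsto_nhdsWithin_iff.2 ⟨hε0, Eventually.of_forall fun n => hε n⟩)
  have hsmall : ∀ᶠ n in atTop, Fintype.card (Fin d × Bool) *
      Real.exp (-(t * (η / 2) * (ε n)⁻¹)) < 1 / 2 := by
    have : Tendsto (fun n => Fintype.card (Fin d × Bool) *
        Real.exp (-(t * (η / 2) * (ε n)⁻¹))) atTop (𝓝 (Fintype.card (Fin d × Bool) * 0)) :=
      (Real.tendsto_exp_neg_atTop_nhds_zero.comp
        (hinv.const_mul_atTop (by positivity))).const_mul _
    rw [mul_zero] at this
    exact this.eventually_lt_const (by norm_num)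
  have hstart : ∀ᶠ n in atTop, ∀ i, |ε n * (xs' n i : ℝ)| < η :=
    Filter.eventually_all.2 fun i =>
      (tendsto_pi_nhds.1 h1 i).abs.eventually_lt_const (by simpa using hη)
  have hend : ∀ᶠ n in atTop, ∀ i, |ε n * (xs n i : ℝ) - Mvec μ i| < η :=
    Filter.eventually_all.2 fun i =>
      ((tendsto_pi_nhds.1 h2 i).sub_const _).abs.eventually_lt_const (by simpa using hη)
  have hCsmall : ∀ᶠ n in atTop, ε n * C < -a / 2 := by
    have := hε0.mul_const C
    rw [zero_mul] at this
    exact this.eventually_lt_const (by linarith)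
  filter_upwards [hsmall, hstart, hend, hCsmall] with n hsmall hstart hend hCsmall
  have hεn := hε n
  set r := η * (ε n)⁻¹ with hr
  have hr0 : 0 < r := by positivity
  set N := ⌊(ε n)⁻¹⌋₊ with hN
  have hN1 : (N : ℝ) ≤ (ε n)⁻¹ := Nat.floor_le (by positivity)
  have hN2 : (ε n)⁻¹ - N ≤ 1 := by linarith [Nat.lt_floor_add_one (ε n)⁻¹]
  set R := ⌈r⌉₊ with hR
  have hR1 : r ≤ R := Nat.le_ceil r
  have hR2 : (R : ℝ) ≤ r + 1 := (Nat.ceil_lt_add_one hr0.le).le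
  set x₀ : Fin d → ℤ := fun i => xs' n i + R with hx₀
  have hx₀mem : x₀ ∈ posDom Λ := fun i hi => by
    have := hxs' n i hi
    simp only [hx₀]
    omega
  have hstart' : ∀ i, |(xs' n i : ℝ)| ≤ r := fun i => by
    have := (hstart i).le
    rw [abs_mul, abs_of_pos hεn] at this
    rw [hr, ← div_eq_mul_inv, le_div_iff₀ hεn]
    linarith
  have hend' : ∀ i, |(xs n i : ℝ) - (ε n)⁻¹ * Mvec μ i| ≤ r := fun i => by
    have h : ε n * (xs n i : ℝ) - Mvec μ i = ε n * ((xs n i : ℝ) - (ε n)⁻¹ * Mvec μ i) := by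
      field_simp
    have := (hend i).le
    rw [h, abs_mul, abs_of_pos hεn] at this
    rw [hr, ← div_eq_mul_inv, le_div_iff₀ hεn]
    linarith
  set D₁ := ∑ _i : Fin d, (r + 1) with hD₁
  set D₂ := ∑ i : Fin d, (4 * r + 1 + |Mvec μ i|) with hD₂
  have hdist₁ : znorm (xs' n - x₀) ≤ D₁ := by
    refine znorm_le_sum fun i => ?_
    simpa [hx₀] using hR2
  have hL : ∀ y ∈ posDom Λ, (∀ i, |(y i : ℝ) - (x₀ i + N * Mvec μ i)| ≤ r) →
      ENNReal.ofReal (Real.exp (-(κ * D₂))) ≤ greenE μ (posDom Λ) y (xs n) := by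
    intro y hy hyr
    have hdist₂ : znorm (y - xs n) ≤ D₂ := by
      refine znorm_le_sum fun i => ?_
      have e : ((y - xs n) i : ℝ) = ((y i : ℝ) - (x₀ i + N * Mvec μ i)) + xs' n i + R -
          ((xs n i : ℝ) - (ε n)⁻¹ * Mvec μ i) - ((ε n)⁻¹ - N) * Mvec μ i := by
        simp only [hx₀, Pi.sub_apply]
        push_cast
        ring
      have e3 : |((ε n)⁻¹ - N) * Mvec μ i| ≤ |Mvec μ i| := by
        rw [abs_mul, abs_of_nonneg (sub_nonneg.2 hN1)]
        exact mul_le_of_le_one_left (abs_nonneg _) hN2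
      rw [e]
      have := abs_le.1 (hyr i)
      have := abs_le.1 (hstart' i)
      have := abs_le.1 (hend' i)
      have := abs_le.1 e3
      rw [abs_le]
      constructor <;> linarith
    refine le_trans ?_ (hHarnack y hy (xs n) (hxs n) (xs n))
    refine le_trans ?_ (le_mul_of_one_le_right (by simp) (one_le_greenE_self μ (hxs n)))
    gcongr
  have htube := half_le_greenE hnn hsum hM (half_pos hη).le ht hφ (x₀ := x₀) (z := xs n)
    (N := N) (r := r) (fun i hi => ?_) (hsmall.le.trans' ?_) ENNReal.ofReal_ne_top hL
  · have hG := (hHarnack _ (hxs' n) x₀ hx₀mem (xs n))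
    have hlow : ENNReal.ofReal (Real.exp (-(κ * D₁) + -(κ * D₂) - Real.log 2)) ≤
        greenE μ (posDom Λ) (xs' n) (xs n) := by
      refine le_trans ?_ hG
      have : Real.exp (-(κ * D₁) + -(κ * D₂) - Real.log 2) =
          Real.exp (-(κ * D₁)) * (Real.exp (-(κ * D₂)) / 2) := by
        rw [Real.exp_sub, Real.exp_add, Real.exp_log two_pos, mul_div_assoc]
      rw [this, ENNReal.ofReal_mul (Real.exp_nonneg _), ENNReal.ofReal_div_of_pos two_pos,
        ENNReal.ofReal_ofNat]
      gcongr
    have hlog : -(κ * D₁) + -(κ * D₂) - Real.log 2 ≤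
        Real.log (green μ (posDom Λ) (xs' n) (xs n)) := by
      rw [Real.le_log_iff_exp_le (green_pos hnn hsum hA1 hA2 hA3 (hxs' n) (hxs n)),
        ← toReal_greenE hnn (kernE_ne_top hnn hsum _)]
      exact (ENNReal.ofReal_le_iff_le_toReal (greenE_ne_top hnn hsum hA2 hA3 _ _ _)).1 hlow
    refine lt_of_lt_of_le ?_ (mul_le_mul_of_nonneg_left hlog hεn.le)
    have hεr : ε n * r = η := by
      rw [hr]
      field_simp
    have hD : D₁ + D₂ = d * (5 * r) + ∑ i, (2 + |Mvec μ i|) := by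
      simp only [hD₁, hD₂, Finset.sum_add_distrib, Finset.sum_const, Finset.card_univ,
        Fintype.card_fin, nsmul_eq_mul]
      ring
    have : ε n * (-(κ * D₁) + -(κ * D₂) - Real.log 2) =
        -(κ * (d * (5 * η))) - ε n * C := by
      rw [← hεr, hC]
      linear_combination (-(ε n * κ)) * hD
    rw [this]
    linarith
  · have : (0 : ℝ) < xs' n i := by exact_mod_cast hxs' n i hi
    simp only [hx₀]
    push_cast
    linarith
  · gcongr
    have : t * (N * (η / 2) - r) ≤ t * ((ε n)⁻¹ * (η / 2) - r) := by gcongr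
    refine this.trans (le_of_eq ?_)
    rw [hr]
    ring

end Asymptotics

theorem statement9 {d : ℕ} (μ : (Fin d → ℤ) → ℝ)
    (hnn : ∀ z, 0 ≤ μ z) (hsum : HasSum μ 1)
    (hA1 : A1 μ) (hA2 : A2 μ) (hA3 : A3 μ)
    (Λ : Set (Fin d)) (hM : ∀ i ∈ Λ, 0 ≤ Mvec μ i)
    (xs xs' : ℕ → (Fin d → ℤ))
    (hxs : ∀ n, xs n ∈ posDom Λ) (hxs' : ∀ n, xs' n ∈ posDom Λ)
    (ε : ℕ → ℝ) (hε : ∀ n, 0 < ε n) (hε0 : Tendsto ε atTop (𝓝 0))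
    (h1 : Tendsto (fun n i => ε n * (xs' n i : ℝ)) atTop (𝓝 0))
    (h2 : Tendsto (fun n i => ε n * (xs n i : ℝ)) atTop (𝓝 (Mvec μ))) :
    Filter.liminf (fun n => ε n * Real.log (green μ (posDom Λ) (xs' n) (xs n))) atTop = 0 := by
  refine Tendsto.liminf_eq (tendsto_order.2 ⟨fun a ha => ?_, fun a ha => ?_⟩)
  · exact eventually_lt_mul_log_green hnn hsum hA1 hA2 hA3 hM hxs hxs' hε hε0 h1 h2 ha
  · exact eventually_mul_log_green_lt hnn hsum hA1 hA2 hA3 hxs hxs' hε hε0 h1 h2 ha
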